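/- Let 0 < p < 1 and n ∈ ℕ. For Bernoulli site percolation with parameter p on the box [0,n]² of the triangular lattice, P_p(A_n) + P_p(B_n) = 1, where A_n is the event of an open left-right crossing and B_n is the event of a closed top-bottom crossing of the box. -/

import Mathlib

open MeasureTheory

abbrev Site := ℤ × ℤ
abbrev Config := Site → Bool

def triAdj (u v : Site) : Prop :=
  u - v ∈ ({(1, 0), (-1, 0), (0, 1), (0, -1), (1, 1), (-1, -1)} : Set Site)

def IsSitePercolation (q : Site → ℝ) (μ : Measure Config) : Prop :=
  IsProbabilityMeasure μ ∧
  ∀ (S : Finset Site) (f : Site → Bool),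
    μ {ω | ∀ v ∈ S, ω v = f v} =
      ∏ v ∈ S, if f v then ENNReal.ofReal (q v) else ENNReal.ofReal (1 - q v)

def IsBernoulliPercolation (p : ℝ) (μ : Measure Config) : Prop :=
  IsSitePercolation (fun _ => p) μ

def IsOpenPath (ω : Config) (l : List Site) : Prop :=
  l ≠ [] ∧ l.Chain' triAdj ∧ ∀ v ∈ l, ω v = true

def openCluster (ω : Config) (v : Site) : Set Site :=
  {w | ∃ l : List Site, IsOpenPath ω l ∧ l.head? = some v ∧ l.getLast? = some w}

/-- The `N × N` screen `{0, …, N−1}²`. -/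
def screen (N : ℕ) : Set Site :=
  {v | 0 ≤ v.1 ∧ v.1 < N ∧ 0 ≤ v.2 ∧ v.2 < N}

/-- The box `[0, n]² = {0, …, n} × {0, …, n}`. -/
def box (n : ℕ) : Set Site :=
  {v | 0 ≤ v.1 ∧ v.1 ≤ n ∧ 0 ≤ v.2 ∧ v.2 ≤ n}

/-- `S` is connected with respect to the triangular-lattice adjacency: any two
of its sites are joined by a path staying inside `S`. -/
def ConnectedIn (S : Set Site) : Prop :=
  ∀ u ∈ S, ∀ w ∈ S, ∃ l : List Site, l.head? = some u ∧ l.getLast? = some w ∧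
    l.Chain' triAdj ∧ ∀ v ∈ l, v ∈ S

/-- The event `F_N(n)`: the screen `{0, …, N−1}²` contains a connected set of at
least `n` open sites. -/
def ClusterEvent (N n : ℕ) : Set Config :=
  {ω | ∃ S : Finset Site, ↑S ⊆ screen N ∧ n ≤ S.card ∧ ConnectedIn ↑S ∧ ∀ v ∈ S, ω v = true}

/-- `l` is a left–right crossing of the box `[0, n]²` all of whose sites carry
the colour `b` (`true` = open/black, `false` = closed/white). -/
def IsLRCrossing (n : ℕ) (b : Bool) (ω : Config) (l : List Site) : Prop :=
  l.Chain' triAdj ∧ (∀ v ∈ l, v ∈ box n ∧ ω v = b) ∧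
  (∃ u, l.head? = some u ∧ u.1 = 0) ∧ (∃ w, l.getLast? = some w ∧ w.1 = n)

/-- `l` is a top–bottom crossing of the box `[0, n]²` all of whose sites carry
the colour `b`. -/
def IsTBCrossing (n : ℕ) (b : Bool) (ω : Config) (l : List Site) : Prop :=
  l.Chain' triAdj ∧ (∀ v ∈ l, v ∈ box n ∧ ω v = b) ∧
  (∃ u, l.head? = some u ∧ u.2 = n) ∧ (∃ w, l.getLast? = some w ∧ w.2 = 0)

/-- The event `A_n`: there is an open left–right crossing of the box `[0, n]²`. -/
def EventA (n : ℕ) : Set Config := {ω | ∃ l, IsLRCrossing n true ω l}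

/-- The event `B_n`: there is a closed top–bottom crossing of the box `[0, n]²`. -/
def EventB (n : ℕ) : Set Config := {ω | ∃ l, IsTBCrossing n false ω l}

/-- There exist `k` pairwise vertex-disjoint open left–right crossings of `[0, n]²`. -/
def HasDisjointCrossings (n : ℕ) (ω : Config) (k : ℕ) : Prop :=
  ∃ L : Fin k → List Site, (∀ i, IsLRCrossing n true ω (L i)) ∧
    ∀ i j, i ≠ j → ∀ v, v ∈ L i → v ∉ L j

/-- The critical probability for site percolation on the triangular lattice:
the supremum of those `p ∈ [0,1]` for which the open cluster of the origin is
almost surely finite. -/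
noncomputable def pcSite : ℝ :=
  sSup {p : ℝ | p ∈ Set.Icc (0 : ℝ) 1 ∧
    ∀ μ : Measure Config, IsBernoulliPercolation p μ →
      μ {ω | (openCluster ω (0, 0)).Infinite} = 0}


/-! ### Paths as chains of monochromatic steps -/

/-- One step of a path of colour `b` in the box `[0, n]²`. -/
def BoxStep (n : ℕ) (b : Bool) (ω : Config) (u w : Site) : Prop :=
  (u ∈ box n ∧ ω u = b) ∧ (w ∈ box n ∧ ω w = b) ∧ triAdj u w

theorem triAdj_iff (u v : Site) : triAdj u v ↔
    (u.1 = v.1 + 1 ∧ u.2 = v.2) ∨ (v.1 = u.1 + 1 ∧ u.2 = v.2) ∨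
    (u.1 = v.1 ∧ u.2 = v.2 + 1) ∨ (u.1 = v.1 ∧ v.2 = u.2 + 1) ∨
    (u.1 = v.1 + 1 ∧ u.2 = v.2 + 1) ∨ (v.1 = u.1 + 1 ∧ v.2 = u.2 + 1) := by
  simp only [triAdj, Set.mem_insert_iff, Set.mem_singleton_iff, Prod.ext_iff, Prod.fst_sub,
    Prod.snd_sub]
  omega

theorem triAdj_symm {u v : Site} (h : triAdj u v) : triAdj v u := by
  rw [triAdj_iff] at *
  omega

theorem boxStep_symm {n : ℕ} {b : Bool} {ω : Config} {u w : Site} (h : BoxStep n b ω u w) :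
    BoxStep n b ω w u :=
  ⟨h.2.1, h.1, triAdj_symm h.2.2⟩

theorem reflTransGen_boxStep_symm {n : ℕ} {b : Bool} {ω : Config} {u w : Site}
    (h : Relation.ReflTransGen (BoxStep n b ω) u w) :
    Relation.ReflTransGen (BoxStep n b ω) w u := by
  induction h with
  | refl => exact .refl
  | tail _ h ih => exact .head (boxStep_symm h) ih

theorem exists_path_iff (n : ℕ) (b : Bool) (ω : Config) (u w : Site) :
    (∃ l : List Site, l.IsChain triAdj ∧ (∀ v ∈ l, v ∈ box n ∧ ω v = b) ∧
      l.head? = some u ∧ l.getLast? = some w) ↔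
    (u ∈ box n ∧ ω u = b) ∧ Relation.ReflTransGen (BoxStep n b ω) u w := by
  constructor
  · rintro ⟨l, hc, hl, hu, hw⟩
    induction l generalizing u with
    | nil => simp at hu
    | cons a l ih =>
      obtain rfl : a = u := by simpa using hu
      refine ⟨hl a (by simp), ?_⟩
      cases l with
      | nil =>
        obtain rfl : a = w := by simpa using hw
        exact .refl
      | cons c l =>
        rw [List.isChain_cons_cons] at hc
        have hc' := ih c hc.2 (fun v hv => hl v (List.mem_cons_of_mem _ hv)) rfl
          (by simpa [List.getLast?_cons_cons] using hw)
        exact .head ⟨hl a (by simp), hc'.1, hc.1⟩ hc'.2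
  · rintro ⟨hu, h⟩
    induction h using Relation.ReflTransGen.head_induction_on with
    | refl => exact ⟨[w], by simp, by simpa using hu, rfl, rfl⟩
    | @head a c hac _ ih =>
      obtain ⟨l, hl, hm, hh, ht⟩ := ih hac.2.1
      cases l with
      | nil => simp at hh
      | cons d l =>
        obtain rfl : d = c := by simpa using hh
        refine ⟨a :: d :: l, List.isChain_cons_cons.2 ⟨hac.2.2, hl⟩, ?_, rfl,
          by simpa [List.getLast?_cons_cons] using ht⟩
        intro v hv
        rcases List.mem_cons.1 hv with rfl | hv
        · exact hu
        · exact hm v hv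

theorem mem_eventA_iff (n : ℕ) (ω : Config) : ω ∈ EventA n ↔
    ∃ u w : Site, u.1 = 0 ∧ w.1 = n ∧ (u ∈ box n ∧ ω u = true) ∧
      Relation.ReflTransGen (BoxStep n true ω) u w := by
  simp only [← exists_path_iff]
  constructor
  · rintro ⟨l, hc, hl, ⟨u, hu, hu0⟩, w, hw, hwn⟩
    exact ⟨u, w, hu0, hwn, l, hc, hl, hu, hw⟩
  · rintro ⟨u, w, hu0, hwn, l, hc, hl, hu, hw⟩
    exact ⟨l, hc, hl, ⟨u, hu, hu0⟩, w, hw, hwn⟩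

theorem mem_eventB_iff (n : ℕ) (ω : Config) : ω ∈ EventB n ↔
    ∃ u w : Site, u.2 = n ∧ w.2 = 0 ∧ (u ∈ box n ∧ ω u = false) ∧
      Relation.ReflTransGen (BoxStep n false ω) u w := by
  simp only [← exists_path_iff]
  constructor
  · rintro ⟨l, hc, hl, ⟨u, hu, hu0⟩, w, hw, hwn⟩
    exact ⟨u, w, hu0, hwn, l, hc, hl, hu, hw⟩
  · rintro ⟨u, w, hu0, hwn, l, hc, hl, hu, hw⟩
    exact ⟨l, hc, hl, ⟨u, hu, hu0⟩, w, hw, hwn⟩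

theorem mem_box_of_reflTransGen {n : ℕ} {b : Bool} {ω : Config} {u w : Site}
    (hu : u ∈ box n ∧ ω u = b) (h : Relation.ReflTransGen (BoxStep n b ω) u w) :
    w ∈ box n ∧ ω w = b := by
  cases h with
  | refl => exact hu
  | tail _ h => exact h.2.1

/-! ### The two crossings cannot coexist -/

/-- Parity of the crossings of the edge `ab` with the leftward horizontal ray that starts just
above `v`. -/
def rayCrossing (a b v : Site) : ZMod 2 :=
  if (a.2 = v.2 ∧ b.2 = v.2 + 1 ∧ a.1 < v.1) ∨ (b.2 = v.2 ∧ a.2 = v.2 + 1 ∧ b.1 < v.1)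
  then 1 else 0

/-- Indicator of the sites strictly to the left of `v` in its row. -/
def leftOf (v a : Site) : ZMod 2 := if a.2 = v.2 ∧ a.1 < v.1 then 1 else 0

/-- Indicator of the sites strictly higher than `v`. -/
def above (v a : Site) : ZMod 2 := if v.2 < a.2 then 1 else 0

theorem rayCrossing_right {a b v : Site} (hav : a ≠ v) (hbv : b ≠ v) :
    rayCrossing a b (v.1 + 1, v.2) = rayCrossing a b v := by
  rw [Ne, Prod.ext_iff] at hav hbv
  simp only [rayCrossing]
  congr 1
  apply propext
  omega

set_option maxHeartbeats 2000000 in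
theorem rayCrossing_up {a b v w : Site} (hab : triAdj a b) (hw : w.2 = v.2 + 1)
    (hvw : w.1 = v.1 ∨ w.1 = v.1 + 1) (hav : a ≠ v) (hbv : b ≠ v) (haw : a ≠ w) (hbw : b ≠ w) :
    rayCrossing a b v + rayCrossing a b w = leftOf w a + leftOf w b := by
  rw [Ne, Prod.ext_iff] at hav hbv haw hbw
  rw [triAdj_iff] at hab
  simp only [rayCrossing, leftOf]
  rcases hab with hab | hab | hab | hab | hab | hab <;> split_ifs <;> first | decide | omega

theorem rayCrossing_of_nonneg {a b v : Site} (ha : 0 ≤ a.1) (hb : 0 ≤ b.1) (hv : v.1 = 0) :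
    rayCrossing a b v = 0 := by
  simp only [rayCrossing]
  rw [if_neg]
  omega

theorem rayCrossing_of_le {n : ℕ} {a b v : Site} (hab : triAdj a b) (ha : a.1 ≤ n) (hb : b.1 ≤ n)
    (hv : v.1 = n) (hav : a ≠ v) (hbv : b ≠ v) :
    rayCrossing a b v = above v a + above v b := by
  rw [Ne, Prod.ext_iff] at hav hbv
  rw [triAdj_iff] at hab
  simp only [rayCrossing, above]
  split_ifs <;> first | decide | omega

/-- Along a path avoiding the sites where `K` fails, the parities of the ray crossings add up to
a function which changes only according to the end points of the path. -/
theorem exists_crossing_parity {n : ℕ} {K : Site → Prop} (hK : ∀ a, K a → 0 ≤ a.1 ∧ a.1 ≤ n)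
    {a b : Site} (h : Relation.ReflTransGen (fun u w => K u ∧ K w ∧ triAdj u w) a b) :
    ∃ c : Site → ZMod 2,
      (∀ v, ¬ K v → c (v.1 + 1, v.2) = c v) ∧
      (∀ v w, ¬ K v → ¬ K w → w.2 = v.2 + 1 → (w.1 = v.1 ∨ w.1 = v.1 + 1) →
        c v + c w = leftOf w a + leftOf w b) ∧
      (∀ v, v.1 = 0 → c v = 0) ∧
      (∀ v, ¬ K v → v.1 = n → c v = above v a + above v b) := by
  have key : ∀ x : ZMod 2, x + x = 0 := by decide
  induction h with
  | refl => exact ⟨fun _ => 0, by simp, by simp [key], by simp, by simp [key]⟩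
  | @tail d e _ hde ih =>
    obtain ⟨c, h1, h2, h3, h4⟩ := ih
    obtain ⟨hd, he, hadj⟩ := hde
    have ne : ∀ {x y : Site}, K x → ¬ K y → x ≠ y := fun hx hy hxy => hy (hxy ▸ hx)
    refine ⟨fun v => c v + rayCrossing d e v, ?_, ?_, ?_, ?_⟩
    · intro v hv
      simp only [h1 v hv, rayCrossing_right (ne hd hv) (ne he hv)]
    · intro v w hv hw hvw hx
      linear_combination h2 v w hv hw hvw hx +
        rayCrossing_up hadj hvw hx (ne hd hv) (ne he hv) (ne hd hw) (ne he hw) + key (leftOf w d)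
    · intro v hv
      simp only [h3 v hv, rayCrossing_of_nonneg (hK d hd).1 (hK e he).1 hv, add_zero]
    · intro v hv hvn
      linear_combination h4 v hv hvn +
        rayCrossing_of_le hadj (hK d hd).2 (hK e he).2 hvn (ne hd hv) (ne he hv) + key (above v d)

theorem disjoint_eventA_eventB (n : ℕ) : Disjoint (EventA n) (EventB n) := by
  rw [Set.disjoint_left]
  intro ω hA hB
  obtain ⟨u, w, hu, hw, hu', huw⟩ := (mem_eventA_iff n ω).1 hA
  obtain ⟨s, t, hs, ht, hs', hst⟩ := (mem_eventB_iff n ω).1 hB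
  let K : Site → Prop := fun a => 0 ≤ a.1 ∧ a.1 ≤ n ∧ (a ∈ box n → ω a = false)
  have hKbox : ∀ a, a ∈ box n ∧ ω a = false → K a := fun a ha => ⟨ha.1.1, ha.1.2.1, fun _ => ha.2⟩
  have hnK : ∀ a, a ∈ box n ∧ ω a = true → ¬ K a := fun a ha hk => by
    simpa [ha.2] using hk.2.2 ha.1
  have hpath : Relation.ReflTransGen (fun u w => K u ∧ K w ∧ triAdj u w) s t :=
    hst.lift id fun x y h => ⟨hKbox x h.1, hKbox y h.2.1, h.2.2⟩
  have hKtop : K (s.1, (n : ℤ) + 1) := by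
    refine ⟨hs'.1.1, hs'.1.2.1, fun h => ?_⟩
    have := h.2.2.2
    simp at this
  obtain ⟨c, h1, h2, h3, h4⟩ := exists_crossing_parity (n := n) (fun a ha => ⟨ha.1, ha.2.1⟩)
    (hpath.head (a := (s.1, (n : ℤ) + 1)) ⟨hKtop, hKbox s hs', by rw [triAdj_iff]; simp [hs]⟩)
  have key : ∀ x y : ZMod 2, x + y = 0 → y = x := by decide
  have hup : ∀ v w : Site, v ∈ box n ∧ ω v = true → w ∈ box n ∧ ω w = true → w.2 = v.2 + 1 →
      (w.1 = v.1 ∨ w.1 = v.1 + 1) → c w = c v := by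
    intro v w hv hw hvw hx
    apply key
    rw [h2 v w (hnK v hv) (hnK w hw) hvw hx]
    have hv2 := hv.1.2.2.1
    have hw2 := hw.1.2.2.2
    simp only [leftOf]
    rw [if_neg, if_neg, add_zero] <;> omega
  have hright : ∀ v w : Site, v ∈ box n ∧ ω v = true → w.1 = v.1 + 1 → w.2 = v.2 → c w = c v := by
    intro v w hv hx hy
    rw [← h1 v (hnK v hv), ← hx, ← hy]
  have hstep : ∀ v w : Site, BoxStep n true ω v w → c w = c v := by
    rintro v w ⟨hv, hw, hadj⟩
    rw [triAdj_iff] at hadj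
    rcases hadj with h | h | h | h | h | h
    · exact (hright w v hw h.1 h.2).symm
    · exact hright v w hv h.1 h.2.symm
    · exact (hup w v hw hv h.2 (.inl h.1)).symm
    · exact hup v w hv hw h.2 (.inl h.1.symm)
    · exact (hup w v hw hv h.2 (.inr h.1)).symm
    · exact hup v w hv hw h.2 (.inr h.1)
  have hconst : c w = c u := by
    clear hw
    induction huw with
    | refl => rfl
    | tail _ h ih => rw [hstep _ _ h, ih]
  have hw' := mem_box_of_reflTransGen hu' huw
  rw [h3 u hu, h4 w (hnK w hw') hw, above, above, if_pos, if_neg, add_zero] at hconst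
  · exact one_ne_zero hconst
  · have := hw'.1.2.2.1
    omega
  · have := hw'.1.2.2.2
    dsimp only
    omega

/-! ### At least one of the two crossings occurs -/

/-- Discrete Green formula on a square, modulo two. -/
theorem sum_boundary_square (n : ℕ) (H V : ℕ → ℕ → ZMod 2)
    (h : ∀ x < n, ∀ y < n, H x (y + 1) - H x y = V (x + 1) y - V x y) :
    ∑ x ∈ Finset.range n, H x n - ∑ x ∈ Finset.range n, H x 0 =
      ∑ y ∈ Finset.range n, V n y - ∑ y ∈ Finset.range n, V 0 y := by
  rw [← Finset.sum_range_sub (fun y => ∑ x ∈ Finset.range n, H x y), ← Finset.sum_sub_distrib]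
  refine Finset.sum_congr rfl fun y hy => ?_
  rw [← Finset.sum_range_sub (fun x => V x y), ← Finset.sum_sub_distrib]
  exact Finset.sum_congr rfl fun x hx => h x (Finset.mem_range.1 hx) y (Finset.mem_range.1 hy)

/-- A Sperner-type lemma: in a two-coloured box, a union `X` of open components containing the open
sites of the left side and a union `Y` of closed components containing the closed sites of the
bottom side cannot avoid the right side and the top side, respectively. -/
theorem exists_mem_right_or_top (n : ℕ) (ω : Config) (X Y : Site → Prop)
    (hXω : ∀ v, X v → ω v = true) (hYω : ∀ v, Y v → ω v = false)
    (hX : ∀ u ∈ box n, ∀ w ∈ box n, triAdj u w → X u → ω w = true → X w)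
    (hY : ∀ u ∈ box n, ∀ w ∈ box n, triAdj u w → Y u → ω w = false → Y w)
    (hleft : ∀ v ∈ box n, v.1 = 0 → ω v = true → X v)
    (hbot : ∀ v ∈ box n, v.2 = 0 → ω v = false → Y v) :
    (∃ v ∈ box n, v.1 = n ∧ X v) ∨ ∃ v ∈ box n, v.2 = n ∧ Y v := by
  classical
  by_contra! hcon
  obtain ⟨hright, htop⟩ := hcon
  let E : Site → Site → ZMod 2 := fun u w => if (X u ∧ Y w) ∨ (Y u ∧ X w) then 1 else 0
  have hE0 : ∀ u v, ω u = ω v → E u v = 0 := fun u v h => if_neg <| by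
    rintro (⟨hx, hy⟩ | ⟨hy, hx⟩)
    · simp [hXω u hx, hYω v hy] at h
    · simp [hXω v hx, hYω u hy] at h
  have hEsymm : ∀ u v, E u v = E v u := fun u v => if_congr (by tauto) rfl rfl
  have hsame : ∀ u ∈ box n, ∀ v ∈ box n, triAdj u v → ω u = ω v →
      (X u ↔ X v) ∧ (Y u ↔ Y v) := fun u hu v hv huv h =>
    ⟨⟨fun hx => hX u hu v hv huv hx (h ▸ hXω u hx),
      fun hx => hX v hv u hu (triAdj_symm huv) hx (h ▸ hXω v hx)⟩,
     ⟨fun hy => hY u hu v hv huv hy (h ▸ hYω u hy),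
      fun hy => hY v hv u hu (triAdj_symm huv) hy (h ▸ hYω v hy)⟩⟩
  have hnX : ∀ v, ω v = false → ¬ X v := fun v h hx => by simpa [h] using hXω v hx
  have hnY : ∀ v, ω v = true → ¬ Y v := fun v h hy => by simpa [h] using hYω v hy
  have hEX : ∀ u ∈ box n, ∀ v ∈ box n, triAdj u v → (ω u = false → Y u) → (ω v = false → Y v) →
      E u v = (if X v then 1 else 0) - if X u then 1 else 0 := by
    intro u hu v hv huv hyu hyv
    by_cases h : ω u = ω v
    · simp only [hE0 u v h, hsame u hu v hv huv h, sub_self]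
    · cases h1 : ω u <;> cases h2 : ω v
      · simp [h1, h2] at h
      · simp [E, hnX u h1, hnY v h2, hyu h1]
      · simp [E, hnX v h2, hnY u h1, hyv h2]
      · simp [h1, h2] at h
  have hEY : ∀ u ∈ box n, ∀ v ∈ box n, triAdj u v → (ω u = true → X u) → (ω v = true → X v) →
      E u v = (if Y v then 1 else 0) - if Y u then 1 else 0 := by
    intro u hu v hv huv hxu hxv
    by_cases h : ω u = ω v
    · simp only [hE0 u v h, hsame u hu v hv huv h, sub_self]
    · cases h1 : ω u <;> cases h2 : ω v
      · simp [h1, h2] at h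
      · simp [E, hnX u h1, hnY v h2, hxv h2]
      · simp [E, hnX v h2, hnY u h1, hxu h1]
      · simp [h1, h2] at h
  have htri : ∀ u ∈ box n, ∀ v ∈ box n, ∀ w ∈ box n, triAdj u v → triAdj v w → triAdj u w →
      E u v + E v w = E u w := by
    intro u hu v hv w hw huv hvw huw
    have hcol : ω u = ω v ∨ ω v = ω w ∨ ω u = ω w := by
      cases ω u <;> cases ω v <;> cases ω w <;> simp
    rcases hcol with h | h | h
    · rw [hE0 u v h, zero_add]
      simp only [E, hsame u hu v hv huv h]
    · rw [hE0 v w h, add_zero]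
      simp only [E, hsame v hv w hw hvw h]
    · rw [hE0 u w h, hEsymm u v]
      simp only [E, hsame u hu w hw huw h]
      split_ifs <;> decide
  let s : ℕ → ℕ → Site := fun x y => ((x : ℤ), (y : ℤ))
  have hs : ∀ x y, x ≤ n → y ≤ n → s x y ∈ box n := fun x y hx hy => by
    simp only [s, box, Set.mem_ofPred_eq]
    omega
  have hadj1 : ∀ x y, triAdj (s x y) (s (x + 1) y) := fun x y => by simp [triAdj_iff, s]
  have hadj2 : ∀ x y, triAdj (s x y) (s x (y + 1)) := fun x y => by simp [triAdj_iff, s]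
  have hadj3 : ∀ x y, triAdj (s x y) (s (x + 1) (y + 1)) := fun x y => by simp [triAdj_iff, s]
  have hgreen := sum_boundary_square n (fun x y => E (s x y) (s (x + 1) y))
    (fun x y => E (s x y) (s x (y + 1))) (fun x hx y hy => by
      have t1 := htri _ (hs x y (by omega) (by omega)) _ (hs (x + 1) y (by omega) (by omega))
        _ (hs (x + 1) (y + 1) (by omega) (by omega)) (hadj1 _ _) (hadj2 _ _) (hadj3 _ _)
      have t2 := htri _ (hs x y (by omega) (by omega)) _ (hs x (y + 1) (by omega) (by omega))
        _ (hs (x + 1) (y + 1) (by omega) (by omega)) (hadj2 _ _) (hadj1 _ _) (hadj3 _ _)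
      linear_combination t2 - t1)
  have htop0 : ∑ x ∈ Finset.range n, E (s x n) (s (x + 1) n) = 0 :=
    Finset.sum_eq_zero fun x hx => if_neg <| by
      have hx := Finset.mem_range.1 hx
      have := htop _ (hs x n hx.le le_rfl) rfl
      have := htop _ (hs (x + 1) n hx le_rfl) rfl
      tauto
  have hright0 : ∑ y ∈ Finset.range n, E (s n y) (s n (y + 1)) = 0 :=
    Finset.sum_eq_zero fun y hy => if_neg <| by
      have hy := Finset.mem_range.1 hy
      have := hright _ (hs n y le_rfl hy.le) rfl
      have := hright _ (hs n (y + 1) le_rfl hy) rfl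
      tauto
  have hbot1 : ∑ x ∈ Finset.range n, E (s x 0) (s (x + 1) 0) = if X (s 0 0) then 1 else 0 := by
    trans ∑ x ∈ Finset.range n,
      ((if X (s (x + 1) 0) then (1 : ZMod 2) else 0) - if X (s x 0) then 1 else 0)
    · refine Finset.sum_congr rfl fun x hx => ?_
      have hx := Finset.mem_range.1 hx
      have m1 := hs x 0 hx.le (Nat.zero_le n)
      have m2 := hs (x + 1) 0 hx (Nat.zero_le n)
      exact hEX _ m1 _ m2 (hadj1 _ _) (hbot _ m1 rfl) (hbot _ m2 rfl)
    · rw [Finset.sum_range_sub (fun x => if X (s x 0) then (1 : ZMod 2) else 0),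
        if_neg (hright _ (hs n 0 le_rfl (Nat.zero_le n)) rfl)]
      split_ifs <;> decide
  have hleft1 : ∑ y ∈ Finset.range n, E (s 0 y) (s 0 (y + 1)) = if Y (s 0 0) then 1 else 0 := by
    trans ∑ y ∈ Finset.range n,
      ((if Y (s 0 (y + 1)) then (1 : ZMod 2) else 0) - if Y (s 0 y) then 1 else 0)
    · refine Finset.sum_congr rfl fun y hy => ?_
      have hy := Finset.mem_range.1 hy
      have m1 := hs 0 y (Nat.zero_le n) hy.le
      have m2 := hs 0 (y + 1) (Nat.zero_le n) hy
      exact hEY _ m1 _ m2 (hadj2 _ _) (hleft _ m1 rfl) (hleft _ m2 rfl)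
    · rw [Finset.sum_range_sub (fun y => if Y (s 0 y) then (1 : ZMod 2) else 0),
        if_neg (htop _ (hs 0 n (Nat.zero_le n) le_rfl) rfl)]
      split_ifs <;> decide
  rw [htop0, hright0, hbot1, hleft1] at hgreen
  have m := hs 0 0 (Nat.zero_le n) (Nat.zero_le n)
  cases h : ω (s 0 0)
  · simp [hbot _ m rfl h, hnX _ h] at hgreen
  · simp [hleft _ m rfl h, hnY _ h] at hgreen

theorem eventA_union_eventB (n : ℕ) : EventA n ∪ EventB n = Set.univ := by
  refine Set.eq_univ_of_forall fun ω => ?_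
  let X : Site → Prop := fun v => ∃ u : Site, u.1 = 0 ∧ (u ∈ box n ∧ ω u = true) ∧
    Relation.ReflTransGen (BoxStep n true ω) u v
  let Y : Site → Prop := fun v => ∃ u : Site, u.2 = 0 ∧ (u ∈ box n ∧ ω u = false) ∧
    Relation.ReflTransGen (BoxStep n false ω) u v
  have hXω : ∀ v, X v → ω v = true := fun v ⟨u, _, hu, h⟩ => (mem_box_of_reflTransGen hu h).2
  have hYω : ∀ v, Y v → ω v = false := fun v ⟨u, _, hu, h⟩ => (mem_box_of_reflTransGen hu h).2
  rcases exists_mem_right_or_top n ω X Y hXω hYω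
    (fun u hu w hw huw hx how => by
      have hou := hXω u hx
      obtain ⟨t, ht, ht', h⟩ := hx
      exact ⟨t, ht, ht', h.tail ⟨⟨hu, hou⟩, ⟨hw, how⟩, huw⟩⟩)
    (fun u hu w hw huw hy how => by
      have hou := hYω u hy
      obtain ⟨t, ht, ht', h⟩ := hy
      exact ⟨t, ht, ht', h.tail ⟨⟨hu, hou⟩, ⟨hw, how⟩, huw⟩⟩)
    (fun v hv hv0 ho => ⟨v, hv0, ⟨hv, ho⟩, .refl⟩)
    (fun v hv hv0 ho => ⟨v, hv0, ⟨hv, ho⟩, .refl⟩)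
    with ⟨v, _, hvn, u, hu0, hu, h⟩ | ⟨v, _, hvn, u, hu0, hu, h⟩
  · exact .inl ((mem_eventA_iff n ω).2 ⟨u, v, hu0, hvn, hu, h⟩)
  · exact .inr ((mem_eventB_iff n ω).2
      ⟨v, u, hvn, hu0, mem_box_of_reflTransGen hu h, reflTransGen_boxStep_symm h⟩)

/-! ### Measurability and conclusion -/

theorem measurableSet_eventB (n : ℕ) : MeasurableSet (EventB n) := by
  have h : ∀ v : Site, MeasurableSet {ω : Config | ω v = false} := fun v =>
    (measurable_pi_apply (X := fun _ : Site => Bool) v) (measurableSet_singleton false)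
  have hB : EventB n = ⋃ l : List Site, {ω | IsTBCrossing n false ω l} := by
    ext ω
    simp [EventB]
  rw [hB]
  refine MeasurableSet.iUnion fun l => ?_
  have hl : MeasurableSet {ω : Config | ∀ v ∈ l, v ∈ box n ∧ ω v = false} :=
    Measurable.setOf <| .forall fun v => .imp measurable_const <|
      .and measurable_const (measurableSet_setOfPred.1 (h v))
  exact (MeasurableSet.const _).inter (hl.inter (.inter (.const _) (.const _)))

/-- Lemma, part 2: `P_p(A_n) + P_p(B_n) = 1` for Bernoulli site percolation on
the box `[0, n]²` of the triangular lattice. -/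
theorem crossing_probabilities_sum (p : ℝ) (hp0 : 0 < p) (hp1 : p < 1) (n : ℕ)
    (μ : Measure Config) (hμ : IsBernoulliPercolation p μ) :
    μ (EventA n) + μ (EventB n) = 1 := by
  have := hμ.1
  rw [← measure_union (disjoint_eventA_eventB n) (measurableSet_eventB n), eventA_union_eventB,
    measure_univ]
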